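/- Fix nonnegative reals λ₁, …, λ_p and, for each ρ > 0, let γ⋆(ρ) be the unique positive solution of (ρ² − ½·Σᵢ λᵢ)·γ − p + ½·Σᵢ √(λᵢ²γ² + 4λᵢγ) = 0. Then γ⋆(ρ) is a decreasing function of ρ on (0, ∞), and γ⋆(ρ) → 0 as ρ → ∞. -/

import Mathlib

/-- The function `x ↦ √(x² + 4x) - x` is nondecreasing on `[0, ∞)`. -/
theorem sqrt_sq_add_four_mul_sub_self_monotoneOn :
    MonotoneOn (fun x : ℝ => √(x ^ 2 + 4 * x) - x) (Set.Ici 0) := by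
  intro x hx y _ hxy
  have hx0 : 0 ≤ x := hx
  have hy0 : 0 ≤ y := hx0.trans hxy
  have hsq : √(y ^ 2 + 4 * y) ^ 2 = y ^ 2 + 4 * y := Real.sq_sqrt (by positivity)
  have hlower : y ≤ √(y ^ 2 + 4 * y) := Real.le_sqrt_of_sq_le (by linarith)
  have hupper : √(y ^ 2 + 4 * y) ≤ y + 2 :=
    Real.sqrt_le_iff.2 ⟨by linarith, by nlinarith⟩
  have key : √(x ^ 2 + 4 * x) ≤ √(y ^ 2 + 4 * y) - (y - x) := by
    refine Real.sqrt_le_iff.2 ⟨by linarith, ?_⟩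
    nlinarith [mul_nonneg (sub_nonneg.2 hxy) (sub_nonneg.2 hupper)]
  change √(x ^ 2 + 4 * x) - x ≤ √(y ^ 2 + 4 * y) - y
  linarith

/-- The defining equation with the linear terms moved under the sum of square roots. -/
theorem sq_mul_add_sum_sqrt_sub_eq {ι : Type*} [Fintype ι] {lam : ι → ℝ} {ρ γ c : ℝ}
    (h : (ρ ^ 2 - (∑ i, lam i) / 2) * γ - c
      + (∑ i, √((lam i) ^ 2 * γ ^ 2 + 4 * lam i * γ)) / 2 = 0) :
    ρ ^ 2 * γ + (∑ i, (√((lam i * γ) ^ 2 + 4 * (lam i * γ)) - lam i * γ)) / 2 = c := by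
  simp only [Finset.sum_sub_distrib, ← Finset.sum_mul, mul_pow, ← mul_assoc]
  linarith

/-- Let `γ⋆(ρ)` denote, for each `ρ > 0`, the unique positive
solution of `(ρ² − ½ Σ λᵢ) γ − p + ½ Σ √(λᵢ²γ² + 4λᵢγ) = 0` (with `λᵢ ≥ 0`).
Then `γ⋆` is decreasing on `(0, ∞)` and `γ⋆(ρ) → 0` as `ρ → ∞`. -/
theorem gamma_star_antitone_tendsto_zero
    {p : ℕ} (hp : 1 ≤ p)
    (lam : Fin p → ℝ) (hlam : ∀ i, 0 ≤ lam i)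
    (γstar : ℝ → ℝ)
    (hγ : ∀ ρ : ℝ, 0 < ρ →
      0 < γstar ρ ∧
      (ρ ^ 2 - (∑ i, lam i) / 2) * γstar ρ - p
        + (∑ i, Real.sqrt ((lam i) ^ 2 * (γstar ρ) ^ 2 + 4 * lam i * γstar ρ)) / 2 = 0) :
    AntitoneOn γstar (Set.Ioi 0) ∧
    Filter.Tendsto γstar Filter.atTop (nhds 0) := by
  have heq := fun ρ hρ => sq_mul_add_sum_sqrt_sub_eq (hγ ρ hρ).2
  have hmono := sqrt_sq_add_four_mul_sub_self_monotoneOn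
  constructor
  · intro a ha b hb hab
    by_contra! hlt
    have ha0 : 0 < a := ha
    have hγa := (hγ a ha).1
    have hγb := (hγ b hb).1
    have hsum : ∑ i, (√((lam i * γstar a) ^ 2 + 4 * (lam i * γstar a)) - lam i * γstar a) ≤
        ∑ i, (√((lam i * γstar b) ^ 2 + 4 * (lam i * γstar b)) - lam i * γstar b) :=
      Finset.sum_le_sum fun i _ => hmono (mul_nonneg (hlam i) hγa.le)
        (mul_nonneg (hlam i) hγb.le) (mul_le_mul_of_nonneg_left hlt.le (hlam i))
    have hprod : a ^ 2 * γstar a < b ^ 2 * γstar b :=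
      calc a ^ 2 * γstar a < a ^ 2 * γstar b := by gcongr
        _ ≤ b ^ 2 * γstar b := by gcongr
    linarith [heq a ha, heq b hb]
  · have hlim : Filter.Tendsto (fun ρ : ℝ => (p : ℝ) / ρ ^ 2) Filter.atTop (nhds 0) :=
      (Filter.tendsto_pow_atTop two_ne_zero).const_div_atTop _
    refine squeeze_zero' ?_ ?_ hlim
    · filter_upwards [Filter.eventually_gt_atTop 0] with ρ hρ using (hγ ρ hρ).1.le
    · filter_upwards [Filter.eventually_gt_atTop 0] with ρ hρ
      have hsum : 0 ≤ ∑ i, (√((lam i * γstar ρ) ^ 2 + 4 * (lam i * γstar ρ)) - lam i * γstar ρ) :=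
        Finset.sum_nonneg fun i _ => by
          have h0 := mul_nonneg (hlam i) (hγ ρ hρ).1.le
          simpa using hmono (Set.mem_Ici.2 le_rfl) h0 h0
      rw [le_div_iff₀ (by positivity)]
      linarith [heq ρ hρ]
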